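/- Let γ > 0, F(x,y) = (Ay, -Aᵀx), R(z) = Π_S(z) - M_γ⁻¹(2Π_S(z) - z), and let Ẑ* = {ẑ ∈ S : gap(ẑ) = 0} be the nonempty set of Nash equilibria. Suppose δ > 0 satisfies dist(ẑ', Ẑ*) ≤ gap(ẑ')/δ for all ẑ' ∈ S. Then for every ẑ ∈ S, the lifted point z = ẑ - γ F(ẑ) satisfies ‖R(z)‖ ≤ (1 + γ‖A‖) gap(ẑ) / δ, where ‖A‖ is the operator (spectral) norm of A. -/

import Mathlib

open Matrix
open scoped InnerProductSpace

noncomputable section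

/-- The probability simplex `Δᵈ = {x ∈ ℝᵈ : xᵢ ≥ 0, ∑ᵢ xᵢ = 1}` in Euclidean space. -/
def simplex (d : ℕ) : Set (EuclideanSpace ℝ (Fin d)) :=
  {x | (∀ i, 0 ≤ x i) ∧ ∑ i, x i = 1}

/-- `S = Δⁿ × Δᵐ ⊆ ℝ^{n+m}`, with coordinates indexed by `Fin n ⊕ Fin m`. -/
def gameSet (n m : ℕ) : Set (EuclideanSpace ℝ (Fin n ⊕ Fin m)) :=
  {z | (∀ i, 0 ≤ z i) ∧ (∑ i : Fin n, z (Sum.inl i)) = 1 ∧ (∑ j : Fin m, z (Sum.inr j)) = 1}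

/-- The skew block matrix `K = [[0, A], [-Aᵀ, 0]]`. -/
def Kmat {n m : ℕ} (A : Matrix (Fin n) (Fin m) ℝ) :
    Matrix (Fin n ⊕ Fin m) (Fin n ⊕ Fin m) ℝ :=
  Matrix.fromBlocks 0 A (-Aᵀ) 0

/-- The block matrix `M_γ = [[I, γA], [-γAᵀ, I]] = I + γK`. -/
def Mmat {n m : ℕ} (A : Matrix (Fin n) (Fin m) ℝ) (γ : ℝ) :
    Matrix (Fin n ⊕ Fin m) (Fin n ⊕ Fin m) ℝ :=
  1 + γ • Kmat A

/-- The game operator `F(x, y) = (A y, -Aᵀ x)`. -/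
def Fop {n m : ℕ} (A : Matrix (Fin n) (Fin m) ℝ)
    (z : EuclideanSpace ℝ (Fin n ⊕ Fin m)) : EuclideanSpace ℝ (Fin n ⊕ Fin m) :=
  Matrix.toEuclideanLin (Kmat A) z

/-- The operator (spectral) norm of a matrix, induced by Euclidean norms. -/
def opNorm {n m : ℕ} (A : Matrix (Fin n) (Fin m) ℝ) : ℝ :=
  ‖LinearMap.toContinuousLinearMap (Matrix.toEuclideanLin A)‖

/-- The duality gap `gap(x, y) = max_{y'∈Δᵐ} xᵀAy' - min_{x'∈Δⁿ} x'ᵀAy`. -/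
def gap {n m : ℕ} (A : Matrix (Fin n) (Fin m) ℝ)
    (z : EuclideanSpace ℝ (Fin n ⊕ Fin m)) : ℝ :=
  sSup ((fun y' : EuclideanSpace ℝ (Fin m) =>
      ∑ i : Fin n, ∑ j : Fin m, z (Sum.inl i) * A i j * y' j) '' simplex m)
    - sInf ((fun x' : EuclideanSpace ℝ (Fin n) =>
      ∑ i : Fin n, ∑ j : Fin m, x' i * A i j * z (Sum.inr j)) '' simplex n)

section SkewBlock

variable {n m : ℕ} (A : Matrix (Fin n) (Fin m) ℝ)

lemma inner_Fop_left (u v : EuclideanSpace ℝ (Fin n ⊕ Fin m)) :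
    ⟪Fop A u, v⟫_ℝ = -⟪u, Fop A v⟫_ℝ := by
  have h : (Kmat A)ᴴ = -Kmat A := by
    simp [Kmat, Matrix.fromBlocks_transpose, Matrix.fromBlocks_neg]
  have key := LinearMap.adjoint_inner_left (Matrix.toEuclideanLin (Kmat A)) v u
  rw [← Matrix.toEuclideanLin_conjTranspose_eq_adjoint, h] at key
  simp only [Fop]
  rw [← key]
  simp

lemma inner_Fop_self (u : EuclideanSpace ℝ (Fin n ⊕ Fin m)) : ⟪Fop A u, u⟫_ℝ = 0 := by
  have h := inner_Fop_left A u u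
  rw [real_inner_comm (Fop A u) u] at h
  linarith

lemma toEuclideanLin_Mmat (γ : ℝ) (v : EuclideanSpace ℝ (Fin n ⊕ Fin m)) :
    Matrix.toEuclideanLin (Mmat A γ) v = v + γ • Fop A v := by
  ext i
  simp [Mmat, Fop]

lemma norm_add_smul_Fop_sq (γ : ℝ) (v : EuclideanSpace ℝ (Fin n ⊕ Fin m)) :
    ‖v + γ • Fop A v‖ ^ 2 = ‖v‖ ^ 2 + γ ^ 2 * ‖Fop A v‖ ^ 2 := by
  rw [norm_add_sq_real, real_inner_smul_right, real_inner_comm, inner_Fop_self, norm_smul,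
    mul_pow, Real.norm_eq_abs, sq_abs]
  ring

lemma isUnit_Mmat (γ : ℝ) : IsUnit (Mmat A γ) := by
  rw [← Matrix.mulVec_injective_iff_isUnit]
  refine (injective_iff_map_eq_zero (Mmat A γ).mulVecLin).2 fun v hv => ?_
  have h := toEuclideanLin_Mmat A γ (WithLp.toLp 2 v)
  have h0 : Matrix.toEuclideanLin (Mmat A γ) (WithLp.toLp 2 v) = 0 := by
    ext i
    simpa using congrFun hv i
  have hsq := norm_add_smul_Fop_sq A γ (WithLp.toLp 2 v)
  rw [← h, h0, norm_zero] at hsq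
  have hz : ‖(WithLp.toLp 2 v : EuclideanSpace ℝ (Fin n ⊕ Fin m))‖ = 0 := by
    have := sq_nonneg (γ * ‖Fop A (WithLp.toLp 2 v)‖)
    exact pow_eq_zero_iff two_ne_zero |>.1 (by nlinarith [sq_nonneg ‖WithLp.toLp 2 v‖])
  simpa using hz

lemma toEuclideanLin_Mmat_inv (γ : ℝ) (w : EuclideanSpace ℝ (Fin n ⊕ Fin m)) :
    Matrix.toEuclideanLin (Mmat A γ) (Matrix.toEuclideanLin (Mmat A γ)⁻¹ w) = w := by
  have h : IsUnit (Mmat A γ).det := (Matrix.isUnit_iff_isUnit_det _).1 (isUnit_Mmat A γ)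
  ext i
  simp [Matrix.mulVec_mulVec, Matrix.mul_nonsing_inv _ h]

lemma Fop_add (u v : EuclideanSpace ℝ (Fin n ⊕ Fin m)) :
    Fop A (u + v) = Fop A u + Fop A v := map_add _ u v

lemma Fop_sub (u v : EuclideanSpace ℝ (Fin n ⊕ Fin m)) :
    Fop A (u - v) = Fop A u - Fop A v := map_sub _ u v

/-- The Cayley transform of a skew matrix is an isometry. -/
lemma norm_eq_of_add_smul_Fop_eq {γ : ℝ} {r v : EuclideanSpace ℝ (Fin n ⊕ Fin m)}
    (h : r + γ • Fop A r = v - γ • Fop A v) : ‖r‖ = ‖v‖ := by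
  have hF : (r - v) + γ • Fop A (r + v) = 0 := by
    have h' := sub_eq_zero.2 h
    rw [← h', Fop_add]
    module
  have h1 : ⟪r - v, r + v⟫_ℝ = 0 := by
    have h2 : r - v = -(γ • Fop A (r + v)) := eq_neg_of_add_eq_zero_left hF
    rw [h2, inner_neg_left, real_inner_smul_left, inner_Fop_self, mul_zero, neg_zero]
  have h3 : ‖r‖ ^ 2 = ‖v‖ ^ 2 := by
    rw [inner_sub_left, inner_add_right, inner_add_right, real_inner_self_eq_norm_sq,
      real_inner_self_eq_norm_sq, real_inner_comm] at h1
    linarith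
  exact (sq_eq_sq₀ (norm_nonneg _) (norm_nonneg _)).1 h3

lemma opNorm_nonneg : 0 ≤ opNorm A := norm_nonneg _

lemma opNorm_transpose : opNorm Aᵀ = opNorm A :=
  (Matrix.l2_opNorm_def Aᵀ).symm.trans <| by
    rw [← Matrix.conjTranspose_eq_transpose_of_trivial, Matrix.l2_opNorm_conjTranspose]
    exact Matrix.l2_opNorm_def A

lemma norm_toEuclideanLin_le (x : EuclideanSpace ℝ (Fin m)) :
    ‖Matrix.toEuclideanLin A x‖ ≤ opNorm A * ‖x‖ :=
  (LinearMap.toContinuousLinearMap (Matrix.toEuclideanLin A)).le_opNorm x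

lemma norm_Fop_le (v : EuclideanSpace ℝ (Fin n ⊕ Fin m)) :
    ‖Fop A v‖ ≤ opNorm A * ‖v‖ := by
  set x : EuclideanSpace ℝ (Fin n) := WithLp.toLp 2 fun i => v (Sum.inl i) with hx
  set y : EuclideanSpace ℝ (Fin m) := WithLp.toLp 2 fun j => v (Sum.inr j) with hy
  have hv : ‖v‖ ^ 2 = ‖x‖ ^ 2 + ‖y‖ ^ 2 := by
    simp [EuclideanSpace.norm_sq_eq, Fintype.sum_sum_type, hx, hy]
  have hF : ‖Fop A v‖ ^ 2 =
      ‖Matrix.toEuclideanLin A y‖ ^ 2 + ‖Matrix.toEuclideanLin Aᵀ x‖ ^ 2 := by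
    simp [EuclideanSpace.norm_sq_eq, Fintype.sum_sum_type, hx, hy, Fop, Kmat,
      Matrix.mulVec, dotProduct, Finset.sum_neg_distrib]
  have h1 := norm_toEuclideanLin_le A y
  have h2 := norm_toEuclideanLin_le Aᵀ x
  rw [opNorm_transpose] at h2
  have h1' := pow_le_pow_left₀ (norm_nonneg _) h1 2
  have h2' := pow_le_pow_left₀ (norm_nonneg _) h2 2
  refine le_of_sq_le_sq ?_ (mul_nonneg (opNorm_nonneg A) (norm_nonneg _))
  rw [mul_pow, hv, hF]
  linarith [mul_pow (opNorm A) ‖x‖ 2, mul_pow (opNorm A) ‖y‖ 2]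

end SkewBlock

section Gap

variable {n m : ℕ} (A : Matrix (Fin n) (Fin m) ℝ)

lemma abs_sum_mul_le_of_mem_simplex {d : ℕ} {x : EuclideanSpace ℝ (Fin d)} (hx : x ∈ simplex d)
    (c : Fin d → ℝ) : |∑ i, c i * x i| ≤ ∑ i, |c i| := by
  refine (Finset.abs_sum_le_sum_abs _ _).trans (Finset.sum_le_sum fun i _ => ?_)
  have h1 : x i ≤ 1 := hx.2 ▸ Finset.single_le_sum (fun j _ => hx.1 j) (Finset.mem_univ i)
  rw [abs_mul, abs_of_nonneg (hx.1 i)]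
  exact mul_le_of_le_one_right (abs_nonneg _) h1

lemma payoff_sub_le_gap (z : EuclideanSpace ℝ (Fin n ⊕ Fin m))
    {x' : EuclideanSpace ℝ (Fin n)} (hx' : x' ∈ simplex n)
    {y' : EuclideanSpace ℝ (Fin m)} (hy' : y' ∈ simplex m) :
    (∑ i, ∑ j, z (Sum.inl i) * A i j * y' j) - ∑ i, ∑ j, x' i * A i j * z (Sum.inr j)
      ≤ gap A z := by
  refine sub_le_sub (le_csSup ?_ ⟨y', hy', rfl⟩) (csInf_le ?_ ⟨x', hx', rfl⟩)
  · refine ⟨∑ j, |∑ i, z (Sum.inl i) * A i j|, ?_⟩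
    rintro _ ⟨y, hy, rfl⟩
    refine le_trans (le_of_eq ?_) ((le_abs_self _).trans (abs_sum_mul_le_of_mem_simplex hy _))
    simp only [Finset.sum_mul]
    exact Finset.sum_comm
  · refine ⟨-∑ i, |∑ j, A i j * z (Sum.inr j)|, ?_⟩
    rintro _ ⟨x, hx, rfl⟩
    refine (neg_le_of_abs_le (abs_sum_mul_le_of_mem_simplex hx _)).trans (le_of_eq ?_)
    simp only [Finset.sum_mul]
    exact Finset.sum_congr rfl fun i _ => Finset.sum_congr rfl fun j _ => by ring

lemma neg_inner_Fop_le_gap (z : EuclideanSpace ℝ (Fin n ⊕ Fin m))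
    {w : EuclideanSpace ℝ (Fin n ⊕ Fin m)} (hw : w ∈ gameSet n m) :
    -⟪Fop A z, w⟫_ℝ ≤ gap A z := by
  have h := payoff_sub_le_gap A z
    (x' := WithLp.toLp 2 fun i => w (Sum.inl i)) ⟨fun i => hw.1 _, hw.2.1⟩
    (y' := WithLp.toLp 2 fun j => w (Sum.inr j)) ⟨fun j => hw.1 _, hw.2.2⟩
  refine le_trans (le_of_eq ?_) h
  have h1 : ∑ i, ∑ j, z (Sum.inl i) * A i j * w (Sum.inr j) =
      ∑ j, w (Sum.inr j) * ∑ i, A i j * z (Sum.inl i) := by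
    rw [Finset.sum_comm]
    simp only [Finset.mul_sum]
    exact Finset.sum_congr rfl fun i _ => Finset.sum_congr rfl fun j _ => by ring
  have h2 : ∑ i, ∑ j, w (Sum.inl i) * A i j * z (Sum.inr j) =
      ∑ i, w (Sum.inl i) * ∑ j, A i j * z (Sum.inr j) := by
    simp only [Finset.mul_sum, mul_assoc]
  simp only [h1, h2]
  simp [PiLp.inner_apply, Fintype.sum_sum_type, Fop, Kmat, Matrix.mulVec, dotProduct,
    Finset.sum_neg_distrib]
  ring

end Gap

lemma convex_gameSet (n m : ℕ) : Convex ℝ (gameSet n m) := by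
  intro u hu v hv a b ha hb hab
  refine ⟨fun i => ?_, ?_, ?_⟩
  · exact add_nonneg (mul_nonneg ha (hu.1 i)) (mul_nonneg hb (hv.1 i))
  · simp [Finset.sum_add_distrib, ← Finset.mul_sum, hu.2.1, hv.2.1, hab]
  · simp [Finset.sum_add_distrib, ← Finset.mul_sum, hu.2.2, hv.2.2, hab]

lemma inner_sub_le_zero_of_forall_norm_le {E : Type*} [NormedAddCommGroup E]
    [InnerProductSpace ℝ E] {S : Set E} (hS : Convex ℝ S) {z p : E} (hp : p ∈ S)
    (hmin : ∀ w ∈ S, ‖z - p‖ ≤ ‖z - w‖) {w : E} (hw : w ∈ S) : ⟪z - p, w - p⟫_ℝ ≤ 0 := by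
  have : Nonempty S := ⟨⟨p, hp⟩⟩
  refine (norm_eq_iInf_iff_real_inner_le_zero hS hp).1 (le_antisymm ?_ ?_) w hw
  · exact le_ciInf fun w => hmin w w.2
  · exact ciInf_le ⟨0, by rintro _ ⟨w, rfl⟩; exact norm_nonneg _⟩ (⟨p, hp⟩ : S)

/-- Error bound for the projected residual of the game operator at an equilibrium `zs`. -/
lemma norm_sub_proj_le {n m : ℕ} (A : Matrix (Fin n) (Fin m) ℝ) {γ : ℝ} (hγ : 0 < γ)
    {zhat zs p : EuclideanSpace ℝ (Fin n ⊕ Fin m)} (hzs : zs ∈ gameSet n m)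
    (hgap : gap A zs = 0) (hp : p ∈ gameSet n m)
    (hmin : ∀ w ∈ gameSet n m, ‖zhat - γ • Fop A zhat - p‖ ≤ ‖zhat - γ • Fop A zhat - w‖) :
    ‖zhat - p‖ ≤ (1 + γ * opNorm A) * ‖zhat - zs‖ := by
  set e := zhat - p with he
  set d := zhat - zs with hd
  have hproj := inner_sub_le_zero_of_forall_norm_le (convex_gameSet n m) hp hmin hzs
  have hnash : 0 ≤ ⟪Fop A zs, p⟫_ℝ := by
    have := neg_inner_Fop_le_gap A zs hp
    linarith
  have hvi : ⟪Fop A zs, e - d⟫_ℝ ≤ 0 := by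
    rw [show e - d = zs - p by rw [he, hd]; abel, inner_sub_right, inner_Fop_self]
    linarith
  have h1 : zhat - γ • Fop A zhat - p = e - γ • Fop A d - γ • Fop A zs := by
    rw [he, hd, Fop_sub]
    module
  rw [h1, show zs - p = e - d by rw [he, hd]; abel, inner_sub_left _ _ (e - d),
    real_inner_smul_left] at hproj
  have h2 : ⟪e - γ • Fop A d, e - d⟫_ℝ ≤ 0 := by nlinarith
  have h3 : ‖e‖ ^ 2 ≤ ⟪d + γ • Fop A d, e⟫_ℝ := by
    rw [inner_sub_left, inner_sub_right e e d, real_inner_smul_left,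
      inner_sub_right (Fop A d) e d, inner_Fop_self, real_inner_self_eq_norm_sq,
      real_inner_comm d e] at h2
    rw [inner_add_left, real_inner_smul_left]
    linarith
  have h4 : ‖e‖ * ‖e‖ ≤ ‖d + γ • Fop A d‖ * ‖e‖ := by
    rw [← sq]
    exact h3.trans (real_inner_le_norm _ _)
  have h5 : ‖d + γ • Fop A d‖ ≤ (1 + γ * opNorm A) * ‖d‖ := by
    refine (norm_add_le _ _).trans ?_
    rw [norm_smul, Real.norm_of_nonneg hγ.le]
    linarith [mul_le_mul_of_nonneg_left (norm_Fop_le A d) hγ.le]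
  rcases (norm_nonneg e).eq_or_lt with h0 | h0
  · rw [← h0]
    exact (norm_nonneg _).trans h5
  · exact (le_of_mul_le_mul_right h4 h0).trans h5

theorem lifted_residual_le_gap {n m : ℕ} (A : Matrix (Fin n) (Fin m) ℝ)
    (γ : ℝ) (hγ : 0 < γ)
    (proj : EuclideanSpace ℝ (Fin n ⊕ Fin m) → EuclideanSpace ℝ (Fin n ⊕ Fin m))
    (hproj : ∀ z, proj z ∈ gameSet n m ∧ ∀ w ∈ gameSet n m, ‖z - proj z‖ ≤ ‖z - w‖)
    (R : EuclideanSpace ℝ (Fin n ⊕ Fin m) → EuclideanSpace ℝ (Fin n ⊕ Fin m))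
    (hR : ∀ z, R z = proj z - Matrix.toEuclideanLin (Mmat A γ)⁻¹ ((2 : ℝ) • proj z - z))
    (Zhat : Set (EuclideanSpace ℝ (Fin n ⊕ Fin m)))
    (hZhat : Zhat = {zhat ∈ gameSet n m | gap A zhat = 0})
    (hne : Zhat.Nonempty)
    (δ : ℝ) (hδ : 0 < δ)
    (hsharp : ∀ zhat' ∈ gameSet n m, Metric.infDist zhat' Zhat ≤ gap A zhat' / δ) :
    ∀ zhat ∈ gameSet n m,
      ‖R (zhat - γ • Fop A zhat)‖ ≤ (1 + γ * opNorm A) * gap A zhat / δ := by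
  intro zhat hz
  set z := zhat - γ • Fop A zhat with hzdef
  have hnorm : ‖R z‖ = ‖zhat - proj z‖ := by
    apply norm_eq_of_add_smul_Fop_eq A (γ := γ)
    rw [← toEuclideanLin_Mmat, hR, map_sub, toEuclideanLin_Mmat_inv, toEuclideanLin_Mmat, Fop_sub,
      hzdef]
    module
  have hc : 0 < 1 + γ * opNorm A := by
    have := mul_nonneg hγ.le (opNorm_nonneg A)
    linarith
  have hdist : ‖zhat - proj z‖ / (1 + γ * opNorm A) ≤ Metric.infDist zhat Zhat := by
    refine (Metric.le_infDist hne).2 fun {zs} hzs => ?_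
    rw [hZhat] at hzs
    rw [div_le_iff₀' hc, dist_eq_norm]
    exact norm_sub_proj_le A hγ hzs.1 hzs.2 (hproj z).1 (hproj z).2
  rw [hnorm, mul_div_assoc, ← div_le_iff₀' hc]
  exact hdist.trans (hsharp zhat hz)

end
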